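/- For every integer k ≥ 2, every strongly-connected digraph G with |V(G)| > 1 has a k-kernel K with (k−1)·(|K| − 1) ≤ |V(G)| − 2 (equivalently |K| ≤ 1 + (|V(G)|−2)/(k−1)). -/

import Mathlib

/-- There is a directed path (walk) of length at most `k` from `x` to `y`
in the digraph with adjacency relation `E`. -/
def ReachesIn {V : Type*} (E : V → V → Prop) : ℕ → V → V → Prop
  | 0, x, y => x = y
  | k + 1, x, y => x = y ∨ ∃ z, E x z ∧ ReachesIn E k z y

/-- `X` k-covers `Y`: every vertex of `Y` is joined from some vertex of `X`
by a directed path of length at most `k`. -/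
def KCovers {V : Type*} (E : V → V → Prop) (k : ℕ) (X Y : Set V) : Prop :=
  ∀ y ∈ Y, ∃ x ∈ X, ReachesIn E k x y

/-- `X` is a stable set: no edge has both ends in `X`. -/
def StableSet {V : Type*} (E : V → V → Prop) (X : Set V) : Prop :=
  ∀ x ∈ X, ∀ y ∈ X, ¬ E x y

/-- A `k`-kernel: a stable set that k-covers the whole vertex set. -/
def IsKernel {V : Type*} (E : V → V → Prop) (k : ℕ) (X : Set V) : Prop :=
  StableSet E X ∧ KCovers E k X Set.univ

/-- A source: a vertex of in-degree zero. -/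
def IsSource {V : Type*} (E : V → V → Prop) (v : V) : Prop := ∀ u, ¬ E u v

/-- An oriented graph: no loops and no directed cycles of length two. -/
def Oriented {V : Type*} (E : V → V → Prop) : Prop :=
  (∀ v, ¬ E v v) ∧ ∀ u v, E u v → ¬ E v u

/-- The induced subdigraph on a set `S` of vertices. -/
def Induce {V : Type*} (E : V → V → Prop) (S : Set V) : V → V → Prop :=
  fun a b => a ∈ S ∧ b ∈ S ∧ E a b

/-- `E` induces a tournament on `T`: any two distinct vertices of `T` are
joined by exactly one directed edge. -/
def IsTournamentOn {V : Type*} (E : V → V → Prop) (T : Set V) : Prop :=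
  ∀ u ∈ T, ∀ v ∈ T, u ≠ v → (E u v ∨ E v u) ∧ ¬ (E u v ∧ E v u)

/-- The relation `E` is acyclic: there is no directed cycle. -/
def AcyclicRel {V : Type*} (E : V → V → Prop) : Prop :=
  ∀ x y, E x y → ¬ Relation.ReflTransGen E y x

/-- A split of an oriented graph: a partition `(S,T)` of the vertex set
where `S` is stable and `T` induces a tournament. -/
def IsSplit {V : Type*} (E : V → V → Prop) (S T : Set V) : Prop :=
  S ∪ T = Set.univ ∧ Disjoint S T ∧ StableSet E S ∧ IsTournamentOn E T

/-- A break of an oriented graph: a partition `(S,T)` of the vertex set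
where `S` induces an acyclic digraph and `T` induces a tournament. -/
def IsBreak {V : Type*} (E : V → V → Prop) (S T : Set V) : Prop :=
  S ∪ T = Set.univ ∧ Disjoint S T ∧ AcyclicRel (Induce E S) ∧ IsTournamentOn E T

/-- `N⁺_G[X]`: the set of vertices that belong to `X` or have an in-neighbour in `X`. -/
def ClosedOut {V : Type*} (E : V → V → Prop) (X : Set V) : Set V :=
  {v | v ∈ X ∨ ∃ x ∈ X, E x v}

namespace ReachesIn

variable {V : Type*} {E : V → V → Prop}

theorem refl (n : ℕ) (x : V) : ReachesIn E n x x := by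
  cases n with
  | zero => rfl
  | succ n => exact Or.inl rfl

theorem mono {m n : ℕ} (hmn : m ≤ n) {x y : V} (h : ReachesIn E m x y) :
    ReachesIn E n x y := by
  induction m generalizing n x with
  | zero => cases h; exact refl n _
  | succ m ih =>
    obtain ⟨n, rfl⟩ : ∃ l, n = l + 1 := ⟨n - 1, by omega⟩
    rcases h with rfl | ⟨z, hxz, hzy⟩
    · exact refl _ x
    · exact Or.inr ⟨z, hxz, ih (by omega) hzy⟩

theorem trans {m n : ℕ} {x y z : V} (hxy : ReachesIn E m x y) (hyz : ReachesIn E n y z) :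
    ReachesIn E (m + n) x z := by
  induction m generalizing x with
  | zero => cases hxy; exact hyz.mono (by omega)
  | succ m ih =>
    rcases hxy with rfl | ⟨w, hxw, hwy⟩
    · exact hyz.mono (by omega)
    · rw [Nat.add_right_comm]
      exact Or.inr ⟨w, hxw, ih hwy⟩

theorem of_adj {x y : V} (h : E x y) : ReachesIn E 1 x y := Or.inr ⟨y, h, rfl⟩

theorem exists_last_edge {n : ℕ} {x y : V} (h : ReachesIn E (n + 1) x y) :
    x = y ∨ ∃ z, ReachesIn E n x z ∧ E z y := by
  induction n generalizing x with
  | zero =>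
    rcases h with h | ⟨z, hxz, hzy⟩
    · exact Or.inl h
    · cases hzy
      exact Or.inr ⟨x, rfl, hxz⟩
  | succ n ih =>
    rcases h with h | ⟨w, hxw, hwy⟩
    · exact Or.inl h
    · rcases ih hwy with rfl | ⟨z, hwz, hzy⟩
      · exact Or.inr ⟨x, refl _ x, hxw⟩
      · exact Or.inr ⟨z, Or.inr ⟨w, hxw, hwz⟩, hzy⟩

theorem exists_of_reflTransGen {x y : V} (h : Relation.ReflTransGen E x y) :
    ∃ n, ReachesIn E n x y := by
  induction h with
  | refl => exact ⟨0, rfl⟩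
  | tail _ hyz ih =>
    obtain ⟨n, hn⟩ := ih
    exact ⟨n + 1, hn.trans (of_adj hyz)⟩

end ReachesIn

/-- Distance layers from a root `r` from which every vertex can be reached. -/
theorem exists_layering {V : Type*} {E : V → V → Prop} {r : V}
    (hr : ∀ v, Relation.ReflTransGen E r v) :
    ∃ d : V → ℕ, (∀ v, d v = 0 ↔ v = r) ∧ (∀ v, E r v → d v ≤ 1) ∧
      ∀ v i, i ≤ d v → ∃ u, d u = d v - i ∧ ReachesIn E i u v := by
  classical
  have hex v : ∃ n, ReachesIn E n r v := ReachesIn.exists_of_reflTransGen (hr v)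
  have hmin {v n} (h : ReachesIn E n r v) : Nat.find (hex v) ≤ n := Nat.find_min' _ h
  refine ⟨fun v => Nat.find (hex v), fun v => ?_, fun v hv => hmin (.of_adj hv), ?_⟩
  · rw [Nat.find_eq_zero]
    exact eq_comm
  intro v i
  induction i with
  | zero => exact fun _ => ⟨v, rfl, rfl⟩
  | succ i ih =>
    intro hi
    obtain ⟨u, hu, huv⟩ := ih (by omega)
    dsimp only at hi hu ⊢
    obtain ⟨l, hl⟩ : ∃ l, Nat.find (hex u) = l + 1 := ⟨Nat.find (hex u) - 1, by omega⟩
    have hlu : ReachesIn E (l + 1) r u := hl ▸ Nat.find_spec (hex u)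
    rcases hlu.exists_last_edge with rfl | ⟨w, hrw, hwu⟩
    · have := hmin (ReachesIn.refl (E := E) 0 r)
      omega
    · have h₁ := hmin hrw
      have h₂ := hmin ((Nat.find_spec (hex w)).trans (.of_adj hwu))
      refine ⟨w, by omega, ?_⟩
      rw [Nat.add_comm]
      exact (ReachesIn.of_adj hwu).trans huv

/-- The Chvátal–Lovász theorem: every finite set of vertices contains a quasi-kernel. -/
theorem exists_quasiKernel_subset {V : Type*} {E : V → V → Prop} (hirr : ∀ v, ¬ E v v)
    (X : Finset V) :
    ∃ K ⊆ X, StableSet E (K : Set V) ∧ KCovers E 2 (K : Set V) (X : Set V) := by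
  classical
  induction X using Finset.strongInduction with
  | H X ih =>
    rcases X.eq_empty_or_nonempty with rfl | ⟨v, hv⟩
    · exact ⟨∅, subset_rfl, by simp [StableSet], by simp [KCovers]⟩
    obtain ⟨K, hKX, hK, hcov⟩ := ih (X.filter fun x => x ≠ v ∧ ¬ E v x)
      (Finset.filter_ssubset.2 ⟨v, hv, by simp⟩)
    have hKX' : K ⊆ X := hKX.trans (Finset.filter_subset _ _)
    by_cases h : ∃ y ∈ K, E y v
    · obtain ⟨y, hy, hyv⟩ := h
      refine ⟨K, hKX', hK, fun x hx => ?_⟩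
      by_cases hxv : x = v
      · exact ⟨y, hy, hxv ▸ (ReachesIn.of_adj hyv).mono (by omega)⟩
      by_cases hvx : E v x
      · exact ⟨y, hy, (ReachesIn.of_adj hyv).trans (.of_adj hvx)⟩
      · exact hcov x (by simp_all)
    · push Not at h
      refine ⟨insert v K, Finset.insert_subset hv hKX', ?_, fun x hx => ?_⟩
      · intro x hx y hy
        rw [Finset.mem_coe, Finset.mem_insert] at hx hy
        rcases hx with rfl | hx <;> rcases hy with rfl | hy
        · exact hirr _
        · exact (Finset.mem_filter.1 (hKX hy)).2.2
        · exact h x hx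
        · exact hK x hx y hy
      · by_cases hxv : x = v
        · exact ⟨v, by simp, hxv ▸ ReachesIn.refl 2 _⟩
        by_cases hvx : E v x
        · exact ⟨v, by simp, (ReachesIn.of_adj hvx).mono (by omega)⟩
        · obtain ⟨y, hy, hyx⟩ := hcov x (by simp_all)
          exact ⟨y, by simp_all, hyx⟩

/-- In a rooted digraph with at least two vertices, some set containing the root `m`-covers
everything and is either small, or nearly small and not stable. -/
theorem exists_small_cover {V : Type*} [Fintype V] {E : V → V → Prop} (hirr : ∀ v, ¬ E v v)
    (hcard : 1 < Fintype.card V) {r : V} (hr : ∀ v, Relation.ReflTransGen E r v) (m : ℕ) :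
    ∃ (c : ℕ) (X : Finset V), X.card = c + 1 ∧ KCovers E m (X : Set V) Set.univ ∧
      ((m + 1) * c + 2 ≤ Fintype.card V ∨
        (m + 1) * c + 1 ≤ Fintype.card V ∧ ¬ StableSet E (X : Set V)) := by
  classical
  obtain ⟨d, hd₀, hd₁, hd⟩ := exists_layering hr
  let C (j : ℕ) : Finset V := (Finset.univ.erase r).filter fun v => d v % (m + 1) = j
  have hX j : (insert r (C j)).card = (C j).card + 1 :=
    Finset.card_insert_of_notMem (by simp [C])
  have hcov j (hj : j < m + 1) : KCovers E m (insert r (C j) : Finset V) Set.univ := by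
    intro v _
    by_cases hv : d v ≤ m
    · obtain ⟨u, hu, huv⟩ := hd v (d v) le_rfl
      obtain rfl := (hd₀ u).1 (by omega)
      exact ⟨u, by simp, huv.mono hv⟩
    · obtain ⟨i, him, hij⟩ : ∃ i ≤ m, (d v - i) % (m + 1) = j := by
        refine ⟨(d v - j) % (m + 1), Nat.lt_succ_iff.1 (Nat.mod_lt _ (by omega)), ?_⟩
        have hdiv := Nat.div_add_mod (d v - j) (m + 1)
        have : d v - (d v - j) % (m + 1) = j + (m + 1) * ((d v - j) / (m + 1)) := by omega
        rw [this, Nat.add_mul_mod_self_left, Nat.mod_eq_of_lt hj]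
      obtain ⟨u, hu, huv⟩ := hd v i (by omega)
      refine ⟨u, ?_, huv.mono him⟩
      by_cases hur : u = r <;> simp [C, hur, hu, hij]
  have hsum : ∑ j ∈ Finset.range (m + 1), (C j).card = Fintype.card V - 1 := by
    rw [← Finset.card_eq_sum_card_fiberwise, Finset.card_erase_of_mem (Finset.mem_univ r),
      Finset.card_univ]
    exact fun v _ => Finset.mem_coe.2 (Finset.mem_range.2 (Nat.mod_lt _ (by omega)))
  by_cases h : ∃ j < m + 1, (m + 1) * (C j).card + 2 ≤ Fintype.card V
  · obtain ⟨j, hj, hjc⟩ := h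
    exact ⟨_, _, hX j, hcov j hj, Or.inl hjc⟩
  push Not at h
  set j := 1 % (m + 1)
  have hj : j < m + 1 := Nat.mod_lt _ (by omega)
  refine ⟨_, _, hX j, hcov j hj, Or.inr ⟨?_, ?_⟩⟩
  · by_contra! hlt
    have := Finset.sum_lt_sum (s := Finset.range (m + 1)) (f := fun _ => Fintype.card V - 1)
      (g := fun i => (m + 1) * (C i).card)
      (fun i hi => by have := h i (Finset.mem_range.1 hi); omega)
      ⟨j, Finset.mem_range.2 hj, by omega⟩
    rw [← Finset.mul_sum, hsum, Finset.sum_const, Finset.card_range, smul_eq_mul] at this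
    exact lt_irrefl _ this
  · have : Nontrivial V := Fintype.one_lt_card_iff_nontrivial.1 hcard
    obtain ⟨v, hv⟩ := exists_ne r
    obtain ⟨w, hrw, -⟩ := (hr v).cases_head.resolve_left hv.symm
    have hwr : w ≠ r := fun h => hirr r (h ▸ hrw)
    have hw : d w = 1 := by
      have := hd₁ w hrw
      have := mt (hd₀ w).1 hwr
      omega
    exact fun hst => hst r (by simp) w (by simp [C, hwr, hw, j]) hrw

/-- For $k \ge 2$: every strongly-connected digraph with more than one vertex has
a $k$-kernel $K$ with $(k-1)(|K|-1) \le |G|-2$. -/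
theorem stmt_11 {V : Type*} [Fintype V] (E : V → V → Prop) (k : ℕ) (hk : 2 ≤ k)
    (hirr : ∀ v, ¬ E v v) (hcard : 1 < Fintype.card V)
    (hsc : ∀ u v : V, Relation.ReflTransGen E u v) :
    ∃ K : Finset V, IsKernel E k (↑K : Set V) ∧
      ((k : ℤ) - 1) * ((K.card : ℤ) - 1) ≤ (Fintype.card V : ℤ) - 2 := by
  obtain ⟨r⟩ : Nonempty V := Fintype.card_pos_iff.1 (by omega)
  obtain ⟨m, rfl⟩ : ∃ m, k = m + 2 := ⟨k - 2, by omega⟩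
  obtain ⟨c, X, hXc, hXcov, hX⟩ := exists_small_cover hirr hcard (hsc r) m
  obtain ⟨K, hKX, hK, hKcov⟩ := exists_quasiKernel_subset hirr X
  refine ⟨K, ⟨hK, fun v hv => ?_⟩, ?_⟩
  · obtain ⟨x, hx, hxv⟩ := hXcov v hv
    obtain ⟨y, hy, hyx⟩ := hKcov x hx
    exact ⟨y, hy, (hyx.trans hxv).mono (by omega)⟩
  · have hle := Finset.card_le_card hKX
    zify at hX hXc hle hcard
    push_cast
    rcases hX with hX | ⟨hX, hXst⟩
    · nlinarith
    · have hlt : K.card < X.card := Finset.card_lt_card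
        (hKX.ssubset_of_ne fun h => hXst (h ▸ hK))
      zify at hlt
      nlinarith
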